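/- arXiv:2602.00530 — 10 statements merged into one kernel-verified Lean document; each statement's English description precedes it below -/
import Mathlib

section
/- Let G' be a finite simple graph whose coline graph co(G') is disconnected, and let G be a finite simple graph containing G' as a subgraph with E(G') ⊆ E(G) and such that adjacency of edges of G' is the same in G' and in G. If |E(G)| < ρ(G') = |E(G')| + c(co(G')), then co(G) is not tough. -/
open SimpleGraph

/-- The coline graph of `G`: the complement of its line graph. Vertices are the
edges of `G`, with two distinct edges adjacent iff they share no endpoint in `G`. -/
def coline {V : Type*} (G : SimpleGraph V) : SimpleGraph G.edgeSet := (G.lineGraph)ᶜ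

/-- A graph is tough (1-tough) if, whenever deleting a vertex set `S` leaves a
disconnected graph, the number of connected components left over is at most `|S|`. -/
def IsTough {W : Type*} (L : SimpleGraph W) : Prop :=
  ∀ S : Set W, ¬ (L.induce Sᶜ).Connected →
    Nat.card (L.induce Sᶜ).ConnectedComponent ≤ Nat.card S

/-- Deleting from `coline G` the edges outside a subgraph `G'` leaves `coline G'`. -/
def colineInduceIso {V : Type*} {G G' : SimpleGraph V} (hsub : G' ≤ G) :
    (coline G).induce {e : G.edgeSet | (e : Sym2 V) ∉ G'.edgeSet}ᶜ ≃g coline G' where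
  toFun e := ⟨e.1.1, not_not.mp e.2⟩
  invFun e := ⟨⟨e.1, edgeSet_mono hsub e.2⟩, not_not.mpr e.2⟩
  left_inv _ := rfl
  right_inv _ := rfl
  map_rel_iff' := by
    rintro ⟨⟨e, he⟩, he'⟩ ⟨⟨f, hf⟩, hf'⟩
    simp [coline, lineGraph]

lemma card_edges_notMem_add {V : Type*} [Fintype V] [DecidableEq V] {G G' : SimpleGraph V}
    [DecidableRel G.Adj] [DecidableRel G'.Adj] (hsub : G' ≤ G) :
    Nat.card {e : G.edgeSet | (e : Sym2 V) ∉ G'.edgeSet} + G'.edgeFinset.card =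
      G.edgeFinset.card := by
  have h := Set.ncard_add_ncard_compl {e : G.edgeSet | (e : Sym2 V) ∉ G'.edgeSet}
  have h' := Nat.card_congr (colineInduceIso hsub).toEquiv
  rw [← Nat.card_coe_set_eq, ← Nat.card_coe_set_eq, h'] at h
  simpa only [Nat.card_eq_fintype_card, ← edgeFinset_card] using h

/-- If `G'` is a subgraph of `G` with disconnected coline graph and `G` has fewer than
`ρ(G') = |E(G')| + c(co(G'))` edges, then the coline graph of `G` is not tough. -/
theorem not_tough_of_few_edges {V : Type*} [Fintype V] [DecidableEq V]
    (G G' : SimpleGraph V) [DecidableRel G.Adj] [DecidableRel G'.Adj]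
    (hsub : G' ≤ G) (hdis : ¬ (coline G').Connected)
    (hcard : G.edgeFinset.card <
      G'.edgeFinset.card + Nat.card (coline G').ConnectedComponent) :
    ¬ IsTough (coline G) := by
  intro htough
  have iso := colineInduceIso hsub
  have hle := htough _ (mt iso.connected_iff.mp hdis)
  rw [Nat.card_congr iso.connectedComponentEquiv] at hle
  have := card_edges_notMem_add hsub
  omega
end

section
/- Let L be a finite simple graph, C a longest cycle in L with a fixed orientation, and H a connected component of L − V(C). If a vertex x of C is adjacent in L to some vertex of H, then neither the successor x⁺ nor the predecessor x⁻ of x on C is adjacent in L to any vertex of H. -/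
open SimpleGraph

/-- The successor, on the oriented cycle `C`, of the vertex in position `i`. -/
def cycSucc {V : Type*} {L : SimpleGraph V} {v : V} (C : L.Walk v v) (i : ℕ) : V :=
  C.getVert ((i + 1) % C.length)

/-- The predecessor, on the oriented cycle `C`, of the vertex in position `i`. -/
def cycPred {V : Type*} {L : SimpleGraph V} {v : V} (C : L.Walk v v) (i : ℕ) : V :=
  C.getVert ((i + C.length - 1) % C.length)

namespace SimpleGraph.Walk

variable {V : Type*} {L : SimpleGraph V}

/-- A walk splits at its `i`-th edge. -/
theorem exists_eq_append_cons {u v : V} (p : L.Walk u v) (i : ℕ) (hi : i < p.length) :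
    ∃ (a : L.Walk u (p.getVert i)) (h : L.Adj (p.getVert i) (p.getVert (i + 1)))
      (b : L.Walk (p.getVert (i + 1)) v), p = a.append (cons h b) := by
  induction p generalizing i with
  | nil => simp at hi
  | cons h q ih =>
    cases i with
    | zero =>
      cases q with
      | nil => exact ⟨nil, h, nil, rfl⟩
      | cons h' q => exact ⟨nil, h, cons h' q, rfl⟩
    | succ i =>
      obtain ⟨a, h', b, hab⟩ := ih i (by simpa using hi)
      simp only [getVert_cons_succ]
      exact ⟨cons h a, h', b, by rw [cons_append, ← hab]⟩

/-- Removing the `i`-th edge of a cycle leaves a path through the other vertices. -/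
theorem IsCycle.exists_isPath_getVert_succ {v : V} {C : L.Walk v v} (hC : C.IsCycle) {i : ℕ}
    (hi : i < C.length) :
    ∃ p : L.Walk (C.getVert (i + 1)) (C.getVert i),
      p.IsPath ∧ p.length + 1 = C.length ∧ p.support ⊆ C.support := by
  obtain ⟨a, h, b, hab⟩ := C.exists_eq_append_cons i hi
  have htail : C.support.tail = a.support.tail ++ b.support := by
    conv_lhs => rw [hab]
    rw [tail_support_append]
    simp
  have hsupp : (b.append a).support = b.support ++ a.support.tail := support_append b a
  refine ⟨b.append a, IsPath.mk' ?_, ?_, ?_⟩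
  · rw [hsupp]
    have hnd := hC.support_nodup
    rw [htail] at hnd
    exact (List.perm_append_comm.nodup_iff).1 hnd
  · have hlen := congrArg length hab
    simp only [length_append, length_cons] at hlen ⊢
    omega
  · intro w hw
    rw [hsupp, List.mem_append] at hw
    refine List.mem_of_mem_tail ?_
    rw [htail, List.mem_append]
    exact hw.symm

/-- Two disjoint paths whose ends are joined by two edges form a cycle, provided one of the paths
is nontrivial. -/
theorem IsPath.isCycle_cons_append_cons {x y h k : V} {p : L.Walk y x} {q : L.Walk h k}
    (hp : p.IsPath) (hq : q.IsPath) (hxy : x ≠ y) (hdisj : ∀ w ∈ q.support, w ∉ p.support)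
    (hxh : L.Adj x h) (hky : L.Adj k y) :
    (cons hxh (q.append (cons hky p))).IsCycle := by
  rw [cons_isCycle_iff]
  constructor
  · refine IsPath.mk' ?_
    rw [support_append, support_cons, List.tail_cons]
    exact hq.support_nodup.append hp.support_nodup hdisj
  · rw [edges_append, edges_cons, List.mem_append, List.mem_cons]
    rintro (hmem | heq | hmem)
    · exact hdisj x (q.fst_mem_support_of_mem_edges hmem) p.end_mem_support
    · rcases Sym2.eq_iff.1 heq with ⟨hxk, -⟩ | ⟨hxy', -⟩
      · exact hdisj x (hxk ▸ q.end_mem_support) p.end_mem_support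
      · exact hxy hxy'
    · exact hdisj h q.start_mem_support (p.snd_mem_support_of_mem_edges hmem)

/-- Consecutive vertices of a longest cycle do not both have neighbours in the same component of
the rest of the graph. -/
theorem IsCycle.not_adj_getVert_succ_of_reachable {v : V} {C : L.Walk v v} (hC : C.IsCycle)
    (hmax : ∀ (u : V) (D : L.Walk u u), D.IsCycle → D.length ≤ C.length)
    {i : ℕ} (hi : i < C.length) {h k : {w | w ∉ C.support}}
    (hreach : (L.induce {w | w ∉ C.support}).Reachable h k)
    (hadj : L.Adj (C.getVert i) h.1) : ¬ L.Adj (C.getVert (i + 1)) k.1 := by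
  intro hadj'
  obtain ⟨p, hp, hlen, hsub⟩ := hC.exists_isPath_getVert_succ hi
  obtain ⟨q, hq⟩ := hreach.exists_isPath
  obtain ⟨r, hr, hdisj⟩ : ∃ r : L.Walk h.1 k.1, r.IsPath ∧ ∀ w ∈ r.support, w ∉ p.support := by
    let f := Embedding.induce (G := L) {w | w ∉ C.support}
    refine ⟨q.map f.toHom, hq.map f.injective, fun w hw hwp => ?_⟩
    have hw' : w ∈ q.support.map f.toHom := support_map f.toHom q ▸ hw
    obtain ⟨z, -, rfl⟩ := List.mem_map.1 hw'
    exact z.2 (hsub hwp)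
  have hcyc := hp.isCycle_cons_append_cons hr (C.adj_getVert_succ hi).ne hdisj hadj hadj'.symm
  have hle := hmax _ _ hcyc
  rw [length_cons, length_append, length_cons] at hle
  omega

theorem getVert_mod_length {v : V} (C : L.Walk v v) {j : ℕ} (hj : j ≤ C.length) :
    C.getVert (j % C.length) = C.getVert j := by
  rcases hj.eq_or_lt with rfl | hlt
  · simp
  · rw [Nat.mod_eq_of_lt hlt]

end SimpleGraph.Walk

/-- Let `C` be a longest cycle of `L` and `H` a connected component of `L - V(C)`.
If a vertex of `C` has a neighbour in `H`, then neither its successor nor its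
predecessor on `C` has a neighbour in `H`. -/
theorem succ_pred_not_adj_component {V : Type*} [Fintype V] (L : SimpleGraph V)
    {v : V} (C : L.Walk v v) (hC : C.IsCycle)
    (hmax : ∀ (u : V) (D : L.Walk u u), D.IsCycle → D.length ≤ C.length)
    (K : (L.induce {w | w ∉ C.support}).ConnectedComponent)
    (i : ℕ) (hi : i < C.length)
    (hadj : ∃ h : {w | w ∉ C.support},
      (L.induce {w | w ∉ C.support}).connectedComponentMk h = K ∧
        L.Adj (C.getVert i) h.1) :
    ∀ h : {w | w ∉ C.support},
      (L.induce {w | w ∉ C.support}).connectedComponentMk h = K →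
        ¬ L.Adj (cycSucc C i) h.1 ∧ ¬ L.Adj (cycPred C i) h.1 := by
  intro k hk
  obtain ⟨h, hh, hadj⟩ := hadj
  have hreach : (L.induce {w | w ∉ C.support}).Reachable h k :=
    ConnectedComponent.exact (hh.trans hk.symm)
  constructor
  · rw [cycSucc, C.getVert_mod_length hi]
    exact hC.not_adj_getVert_succ_of_reachable hmax hi hreach hadj
  · intro hpred
    have hj : (i + C.length - 1) % C.length < C.length := Nat.mod_lt _ (by omega)
    refine hC.not_adj_getVert_succ_of_reachable hmax hj hreach.symm hpred ?_
    have hsucc : ((i + C.length - 1) % C.length + 1) % C.length = i := by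
      rw [Nat.mod_add_mod, Nat.sub_add_cancel (by omega), Nat.add_mod_right,
        Nat.mod_eq_of_lt hi]
    rwa [← C.getVert_mod_length hj, hsucc]
end

section
/- Let L be a finite simple graph, C a longest cycle in L with a fixed orientation, and H a connected component of L − V(C). If x and y are distinct vertices of N_L(H), then L contains no path from x⁺ to y⁺ and no path from x⁻ to y⁻ all of whose internal vertices lie in L − V(C). -/
open SimpleGraph

namespace SimpleGraph.Walk

variable {V : Type*} {L : SimpleGraph V}

lemma IsPath.append_of_inter {a b c : V} {p : L.Walk a b} {q : L.Walk b c}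
    (hp : p.IsPath) (hq : q.IsPath)
    (h : ∀ z ∈ p.support, z ∈ q.support → z = b) : (p.append q).IsPath := by
  rw [isPath_def] at *
  rw [support_append, List.nodup_append']
  rw [← cons_tail_support] at hq
  refine ⟨hp, hq.of_cons, fun z hz hz' => ?_⟩
  have := h z hz (List.mem_of_mem_tail hz')
  exact (List.nodup_cons.1 hq).1 (this ▸ hz')

lemma IsPath.cons_isCycle {x a : V} {R : L.Walk a x} (hR : R.IsPath) (h : L.Adj x a)
    (hlen : 2 ≤ R.length) : (cons h R).IsCycle := by
  rw [cons_isCycle_iff]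
  refine ⟨hR, fun hmem => ?_⟩
  cases R with
  | nil => simp at hlen
  | cons h' R' =>
    rw [cons_isPath_iff] at hR
    rw [edges_cons, List.mem_cons] at hmem
    rcases hmem with hmem | hmem
    · obtain ⟨h1, -⟩ | ⟨rfl, -⟩ := Sym2.eq_iff.1 hmem
      · exact absurd h1 h.ne
      have := length_eq_zero_iff.2 (isPath_iff_nil.1 hR.1)
      rw [length_cons] at hlen
      omega
    · exact hR.2 (snd_mem_support_of_mem_edges _ hmem)

/-- The walk `f a, f (a + 1), …, f (a + m)`. -/
def ofFun (f : ℕ → V) (hf : ∀ k, L.Adj (f k) (f (k + 1))) (a : ℕ) :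
    (m : ℕ) → L.Walk (f a) (f (a + m))
  | 0 => nil
  | m + 1 => (ofFun f hf a m).concat (hf (a + m))

lemma length_ofFun (f : ℕ → V) (hf : ∀ k, L.Adj (f k) (f (k + 1))) (a m : ℕ) :
    (ofFun f hf a m).length = m := by
  induction m with
  | zero => rfl
  | succ m ih => simp [ofFun, ih]

lemma support_ofFun (f : ℕ → V) (hf : ∀ k, L.Adj (f k) (f (k + 1))) (a m : ℕ) :
    (ofFun f hf a m).support = (List.range' a (m + 1)).map f := by
  induction m with
  | zero => rfl
  | succ m ih =>
    rw [ofFun, support_concat, ih, List.range'_concat (n := m + 1)]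
    simp

end SimpleGraph.Walk

namespace SimpleGraph

variable {V : Type*} {L : SimpleGraph V}

lemma ConnectedComponent.exists_isPath_induce {T : Set V} {K : (L.induce T).ConnectedComponent}
    {a b : T} (ha : (L.induce T).connectedComponentMk a = K)
    (hb : (L.induce T).connectedComponentMk b = K) :
    ∃ q : L.Walk a.1 b.1, q.IsPath ∧
      ∀ z ∈ q.support, ∃ hz : z ∈ T, (L.induce T).connectedComponentMk ⟨z, hz⟩ = K := by
  classical
  obtain ⟨w, hw⟩ := (ConnectedComponent.exact (ha.trans hb.symm)).exists_isPath
  refine ⟨w.map (Embedding.induce T).toHom,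
    hw.map (Embedding.induce (G := L) T).injective, fun z hz => ?_⟩
  replace hz := (congrArg (z ∈ ·) (Walk.support_map _ w)).mp hz
  rw [List.mem_map] at hz
  obtain ⟨u, hu, rfl⟩ := hz
  refine ⟨u.2, ?_⟩
  rw [← ha]
  exact (ConnectedComponent.sound ⟨w.takeUntil u hu⟩).symm

lemma ConnectedComponent.exists_adj_of_isPath {T : Set V} {K : (L.induce T).ConnectedComponent}
    {s t : V} (p : L.Walk s t) (hp : p.IsPath) (hs : s ∉ T) (ht : t ∉ T)
    (hpT : ∀ z ∈ p.support, z ≠ s → z ≠ t → z ∈ T) {z : V} (hz : z ∈ p.support) (hzT : z ∈ T)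
    (hzK : (L.induce T).connectedComponentMk ⟨z, hzT⟩ = K) :
    ∃ a : T, (L.induce T).connectedComponentMk a = K ∧ L.Adj s a.1 := by
  classical
  have hzt : z ≠ t := fun h => ht (h ▸ hzT)
  have hw := hp.takeUntil hz
  have hwt := Walk.endpoint_notMem_support_takeUntil hp hz hzt.symm
  have hwp := p.support_takeUntil_subset_support hz
  generalize p.takeUntil z hz = w at hw hwt hwp
  cases w with
  | nil => exact absurd hzT hs
  | @cons _ a _ h w =>
    rw [Walk.cons_isPath_iff] at hw
    have hwT : ∀ u ∈ w.support, u ∈ T := fun u hu =>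
      hpT u (hwp (by simp [hu])) (fun h => hw.2 (h ▸ hu)) (fun h => hwt (by simp [← h, hu]))
    refine ⟨⟨a, hwT a w.start_mem_support⟩, ?_, h⟩
    rw [← hzK]
    exact ConnectedComponent.sound ⟨w.induce T hwT⟩

/-- Here `x s ⋯ y t ⋯ x` is a longest cycle, given by the paths `P₁` from `s` to `y` and
`P₂` from `t` to `x`. -/
lemma false_of_isPath_between_succs {n : ℕ}
    (hmax : ∀ (u : V) (D : L.Walk u u), D.IsCycle → D.length ≤ n)
    {x s y t : V} {P₁ : L.Walk s y} {P₂ : L.Walk t x} (hP₁ : P₁.IsPath) (hP₂ : P₂.IsPath)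
    (hdisj : ∀ z ∈ P₁.support, z ∉ P₂.support) (hyt : L.Adj y t)
    (hlen : n = P₁.length + P₂.length + 2) {T : Set V}
    (hT₁ : ∀ z ∈ P₁.support, z ∉ T) (hT₂ : ∀ z ∈ P₂.support, z ∉ T)
    (K : (L.induce T).ConnectedComponent)
    (hx : ∃ h : T, (L.induce T).connectedComponentMk h = K ∧ L.Adj x h.1)
    (hy : ∃ h : T, (L.induce T).connectedComponentMk h = K ∧ L.Adj y h.1)
    (p : L.Walk s t) (hp : p.IsPath) (hpT : ∀ z ∈ p.support, z ≠ s → z ≠ t → z ∈ T) :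
    False := by
  obtain ⟨a, haK, hxa⟩ := hx
  obtain ⟨b, hbK, hyb⟩ := hy
  have hs₁ := P₁.start_mem_support
  have hy₁ := P₁.end_mem_support
  have ht₂ := P₂.start_mem_support
  have hx₂ := P₂.end_mem_support
  by_cases hpK : ∃ z ∈ p.support, ∃ hz : z ∈ T, (L.induce T).connectedComponentMk ⟨z, hz⟩ = K
  · obtain ⟨z, hzp, hzT, hzK⟩ := hpK
    obtain ⟨c, hcK, hsc⟩ := ConnectedComponent.exists_adj_of_isPath p hp (hT₁ s hs₁) (hT₂ t ht₂)
      hpT hzp hzT hzK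
    obtain ⟨q, hq, hqK⟩ := ConnectedComponent.exists_isPath_induce haK hcK
    have hqT : ∀ z ∈ q.support, z ∈ T := fun z hz => (hqK z hz).1
    have h₁ : (P₁.append (Walk.cons hyt P₂)).IsPath := by
      refine hP₁.append_of_inter (hP₂.cons (hdisj y hy₁)) fun z hz hz' => ?_
      rw [Walk.support_cons, List.mem_cons] at hz'
      exact hz'.resolve_right (hdisj z hz)
    have hm : ∀ z ∈ (P₁.append (Walk.cons hyt P₂)).support, z ∉ T := by
      intro z hz
      rw [Walk.mem_support_append_iff, Walk.support_cons, List.mem_cons] at hz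
      rcases hz with hz | rfl | hz
      exacts [hT₁ z hz, hT₁ z hy₁, hT₂ z hz]
    have h₂ : (q.append (Walk.cons hsc.symm (P₁.append (Walk.cons hyt P₂)))).IsPath := by
      refine hq.append_of_inter (h₁.cons fun h => hm _ h c.2) fun z hz hz' => ?_
      rw [Walk.support_cons, List.mem_cons] at hz'
      exact hz'.resolve_right fun h => hm z h (hqT z hz)
    have := hmax _ _ (h₂.cons_isCycle hxa (by simp; omega))
    simp at this
    omega
  · obtain ⟨q, hq, hqK⟩ := ConnectedComponent.exists_isPath_induce haK hbK
    have h₀ : (p.append P₂).IsPath := by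
      refine hp.append_of_inter hP₂ fun z hz hz' => ?_
      by_contra hzt
      exact hT₂ z hz' (hpT z hz (fun h => hdisj s hs₁ (h ▸ hz')) hzt)
    have h₁ : (P₁.reverse.append (p.append P₂)).IsPath := by
      refine hP₁.reverse.append_of_inter h₀ fun z hz hz' => ?_
      rw [Walk.support_reverse, List.mem_reverse] at hz
      rw [Walk.mem_support_append_iff] at hz'
      have hz' := hz'.resolve_right (hdisj z hz)
      by_contra hzs
      exact hT₁ z hz (hpT z hz' hzs (fun h => hdisj z hz (h ▸ ht₂)))
    have hm : ∀ z ∈ (P₁.reverse.append (p.append P₂)).support, z ∉ q.support := by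
      intro z hz hzq
      rw [Walk.mem_support_append_iff, Walk.mem_support_append_iff, Walk.support_reverse,
        List.mem_reverse] at hz
      rcases hz with hz | hz | hz
      exacts [hT₁ z hz (hqK z hzq).1, hpK ⟨z, hz, hqK z hzq⟩, hT₂ z hz (hqK z hzq).1]
    have h₂ : (q.append (Walk.cons hyb.symm (P₁.reverse.append (p.append P₂)))).IsPath := by
      refine hq.append_of_inter (h₁.cons fun h => hm _ h q.end_mem_support) fun z hz hz' => ?_
      rw [Walk.support_cons, List.mem_cons] at hz'
      exact hz'.resolve_right fun h => hm z h hz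
    have hp0 : p.length ≠ 0 := fun h => hdisj s hs₁ (Walk.eq_of_length_eq_zero h ▸ ht₂)
    have := hmax _ _ (h₂.cons_isCycle hxa (by simp; omega))
    simp at this
    omega

lemma false_of_isPath_between_succs_of_fun {n : ℕ}
    (hmax : ∀ (u : V) (D : L.Walk u u), D.IsCycle → D.length ≤ n)
    (f : ℕ → V) (hf : ∀ k, L.Adj (f k) (f (k + 1))) (hper : ∀ k, f (k + n) = f k)
    (hinj : ∀ a b, f a = f b → a ≡ b [MOD n]) {T : Set V} (hT : ∀ k, f k ∉ T)
    (K : (L.induce T).ConnectedComponent) {i j : ℕ} (hij : i ≠ j) (hin : i < j + n)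
    (hjn : j < i + n)
    (hx : ∃ h : T, (L.induce T).connectedComponentMk h = K ∧ L.Adj (f i) h.1)
    (hy : ∃ h : T, (L.induce T).connectedComponentMk h = K ∧ L.Adj (f j) h.1)
    (p : L.Walk (f (i + 1)) (f (j + 1))) (hp : p.IsPath)
    (hpT : ∀ z ∈ p.support, z ≠ f (i + 1) → z ≠ f (j + 1) → z ∈ T) :
    False := by
  wlog hlt : i < j generalizing i j
  · exact this hij.symm hjn hin hy hx p.reverse hp.reverse
      (fun z hz h1 h2 => hpT z (by simpa using hz) h2 h1) (by omega)
  have hinj' : ∀ a b, f a = f b → a ≤ b → b < a + n → a = b := by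
    intro a b h hab hb
    have := (Nat.modEq_iff_dvd' hab).1 (hinj a b h)
    have := Nat.eq_zero_of_dvd_of_lt this (by omega)
    omega
  have hpath : ∀ a m, m < n → (Walk.ofFun f hf a m).IsPath := by
    intro a m hm
    rw [Walk.isPath_def, Walk.support_ofFun]
    refine List.Nodup.map_on (fun u hu w hw h => ?_) List.nodup_range'
    rw [List.mem_range'_1] at hu hw
    rcases le_total u w with h' | h'
    · exact hinj' u w h h' (by omega)
    · exact (hinj' w u h.symm h' (by omega)).symm
  obtain ⟨m, rfl⟩ : ∃ m, j = i + 1 + m := ⟨j - (i + 1), by omega⟩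
  obtain ⟨l, hl⟩ : ∃ l, i + n = i + 1 + m + 1 + l := ⟨i + n - (i + 1 + m + 1), by omega⟩
  refine false_of_isPath_between_succs hmax (P₁ := Walk.ofFun f hf (i + 1) m)
    (P₂ := Walk.ofFun f hf (i + 1 + m + 1) l) (hpath _ _ (by omega)) (hpath _ _ (by omega))
    ?_ (hf _) ?_ ?_ ?_ K ?_ hy p hp hpT
  · intro z hz hz'
    rw [Walk.support_ofFun, List.mem_map] at hz hz'
    obtain ⟨u, hu, rfl⟩ := hz
    obtain ⟨w, hw, h⟩ := hz'
    rw [List.mem_range'_1] at hu hw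
    have := hinj' u w h.symm (by omega) (by omega)
    omega
  · rw [Walk.length_ofFun, Walk.length_ofFun]
    omega
  · intro z hz
    rw [Walk.support_ofFun, List.mem_map] at hz
    obtain ⟨u, -, rfl⟩ := hz
    exact hT u
  · intro z hz
    rw [Walk.support_ofFun, List.mem_map] at hz
    obtain ⟨u, -, rfl⟩ := hz
    exact hT u
  · rwa [← hl, hper]

lemma Walk.IsCycle.adj_getVert_mod {v : V} {C : L.Walk v v} (hC : C.IsCycle) (k : ℕ) :
    L.Adj (C.getVert (k % C.length)) (C.getVert ((k + 1) % C.length)) := by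
  have h3 := hC.three_le_length
  have hlt : k % C.length < C.length := Nat.mod_lt _ (by omega)
  have h := C.adj_getVert_succ hlt
  rw [← Nat.mod_add_mod]
  rcases Nat.lt_or_ge (k % C.length + 1) C.length with h' | h'
  · rwa [Nat.mod_eq_of_lt h']
  · have he : k % C.length + 1 = C.length := by omega
    rw [he, Walk.getVert_length] at h
    rwa [he, Nat.mod_self, Walk.getVert_zero]

lemma Walk.IsCycle.modEq_of_getVert_mod_eq {v : V} {C : L.Walk v v} (hC : C.IsCycle) {a b : ℕ}
    (h : C.getVert (a % C.length) = C.getVert (b % C.length)) : a ≡ b [MOD C.length] := by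
  have h3 := hC.three_le_length
  have ha : a % C.length < C.length := Nat.mod_lt _ (by omega)
  have hb : b % C.length < C.length := Nat.mod_lt _ (by omega)
  exact hC.getVert_injOn' (by simp; omega) (by simp; omega) h

lemma Walk.IsCycle.false_of_isPath_between_cycSucc {v : V} {C : L.Walk v v} (hC : C.IsCycle)
    (hmax : ∀ (u : V) (D : L.Walk u u), D.IsCycle → D.length ≤ C.length) {T : Set V}
    (hT : ∀ z ∈ C.support, z ∉ T)
    (K : (L.induce T).ConnectedComponent)
    {i j : ℕ} (hi : i < C.length) (hj : j < C.length) (hij : i ≠ j)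
    (hx : ∃ h : T, (L.induce T).connectedComponentMk h = K ∧ L.Adj (C.getVert i) h.1)
    (hy : ∃ h : T, (L.induce T).connectedComponentMk h = K ∧ L.Adj (C.getVert j) h.1)
    (p : L.Walk (cycSucc C i) (cycSucc C j)) (hp : p.IsPath)
    (hpT : ∀ z ∈ p.support, z ≠ cycSucc C i → z ≠ cycSucc C j → z ∈ T) : False := by
  refine false_of_isPath_between_succs_of_fun hmax (fun k => C.getVert (k % C.length))
    hC.adj_getVert_mod (fun k => by simp) (fun a b => hC.modEq_of_getVert_mod_eq)
    (fun k => hT _ (C.getVert_mem_support _)) K hij (by omega) (by omega) ?_ ?_ p hp hpT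
  · simpa only [Nat.mod_eq_of_lt hi] using hx
  · simpa only [Nat.mod_eq_of_lt hj] using hy

lemma Walk.getVert_reverse_sub_mod {v : V} (C : L.Walk v v) {i : ℕ} (hi : i < C.length) :
    C.reverse.getVert ((C.length - i) % C.length) = C.getVert i := by
  rcases Nat.eq_zero_or_pos i with rfl | h
  · simp
  · rw [Nat.mod_eq_of_lt (by omega), Walk.getVert_reverse]
    congr 1
    omega

lemma cycSucc_reverse {v : V} (C : L.Walk v v) {i : ℕ} (hi : i < C.length) :
    cycSucc C.reverse ((C.length - i) % C.length) = cycPred C i := by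
  rw [cycSucc, cycPred, Walk.length_reverse, Nat.mod_add_mod]
  rcases Nat.eq_zero_or_pos i with rfl | h
  · rw [Nat.sub_zero, Nat.add_mod_left, Walk.getVert_reverse, Nat.zero_add,
      Nat.mod_eq_of_lt (a := C.length - 1) (by omega)]
    rcases Nat.lt_or_ge 1 C.length with h1 | h1
    · rw [Nat.mod_eq_of_lt h1]
    · obtain h1 : C.length = 1 := by omega
      simp [h1]
      rw [← h1, Walk.getVert_length]
  · have e : i + C.length - 1 = (i - 1) + C.length := by omega
    rw [e, Nat.add_mod_right, Nat.mod_eq_of_lt (a := i - 1) (by omega)]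
    rcases Nat.lt_or_ge 1 i with h1 | h1
    · rw [Nat.mod_eq_of_lt (by omega), Walk.getVert_reverse]
      congr 1
      omega
    · obtain rfl : i = 1 := by omega
      rw [Nat.sub_add_cancel (by omega)]
      simp

end SimpleGraph

/-- Let `C` be a longest cycle of `L`, `H` a connected component of `L - V(C)`, and
`x = C.getVert i`, `y = C.getVert j` two distinct vertices of `N_L(H)`. Then there is no
path from `x⁺` to `y⁺`, and no path from `x⁻` to `y⁻`, all of whose internal vertices
avoid `C`. -/
theorem no_path_between_succs {V : Type*} [Fintype V] (L : SimpleGraph V)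
    {v : V} (C : L.Walk v v) (hC : C.IsCycle)
    (hmax : ∀ (u : V) (D : L.Walk u u), D.IsCycle → D.length ≤ C.length)
    (K : (L.induce {w | w ∉ C.support}).ConnectedComponent)
    (i j : ℕ) (hi : i < C.length) (hj : j < C.length)
    (hne : C.getVert i ≠ C.getVert j)
    (hadji : ∃ h : {w | w ∉ C.support},
      (L.induce {w | w ∉ C.support}).connectedComponentMk h = K ∧
        L.Adj (C.getVert i) h.1)
    (hadjj : ∃ h : {w | w ∉ C.support},
      (L.induce {w | w ∉ C.support}).connectedComponentMk h = K ∧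
        L.Adj (C.getVert j) h.1) :
    (¬ ∃ p : L.Walk (cycSucc C i) (cycSucc C j), p.IsPath ∧
        ∀ z ∈ p.support, z ≠ cycSucc C i → z ≠ cycSucc C j → z ∉ C.support) ∧
    (¬ ∃ p : L.Walk (cycPred C i) (cycPred C j), p.IsPath ∧
        ∀ z ∈ p.support, z ≠ cycPred C i → z ≠ cycPred C j → z ∉ C.support) := by
  have hij : i ≠ j := fun h => hne (h ▸ rfl)
  have hT : ∀ z ∈ C.support, z ∉ {w | w ∉ C.support} := fun z hz h => h hz
  refine ⟨fun ⟨p, hp, hpT⟩ =>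
    hC.false_of_isPath_between_cycSucc hmax hT K hi hj hij hadji hadjj p hp hpT,
    fun ⟨p, hp, hpT⟩ => ?_⟩
  rw [← C.getVert_reverse_sub_mod hi] at hadji
  rw [← C.getVert_reverse_sub_mod hj] at hadjj
  rw [← C.getVert_reverse_sub_mod hi, ← C.getVert_reverse_sub_mod hj] at hne
  revert p
  rw [← cycSucc_reverse C hi, ← cycSucc_reverse C hj]
  intro p hp hpT
  have hpos : 0 < C.length := by omega
  exact hC.reverse.false_of_isPath_between_cycSucc (by simpa using hmax)
    (fun z hz => hT z (by simpa using hz)) K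
    (by simpa using Nat.mod_lt _ hpos) (by simpa using Nat.mod_lt _ hpos)
    (fun h => hne (congrArg _ h)) hadji hadjj p hp hpT
end

section
/- Let L be a finite simple graph, C a longest cycle in L with a fixed orientation, and x a vertex of L not on C all of whose neighbours lie on C; let x_1, …, x_d be these neighbours in order around C. Suppose x_i, x_j, x_k are among these neighbours with x_i ≠ x_j, x_i ≠ x_k, and traversing C from x_i in the direction of the orientation one meets x_j no later than x_k (possibly x_j = x_k). Then either none of x_i⁺x_j, x_i⁻x_j, x_i⁺x_k, x_i⁻x_k is an edge of L, or x_j⁻x_k⁺ is not an edge of L. In particular, for distinct neighbours x_i, x_j of x, either neither x_i⁺x_j nor x_i⁻x_j is an edge of L, or x_j⁻x_j⁺ is not an edge of L. -/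
open SimpleGraph

/-- A sequence of vertices with consecutive terms adjacent is traversed by a walk. -/
theorem exists_walk_support_eq_map_range {V : Type*} {G : SimpleGraph V} (h : ℕ → V) (m : ℕ)
    (hadj : ∀ i < m, G.Adj (h i) (h (i + 1))) :
    ∃ p : G.Walk (h 0) (h m), p.length = m ∧ p.support = (List.range (m + 1)).map h := by
  induction m with
  | zero => exact ⟨Walk.nil, by simp⟩
  | succ m ih =>
    obtain ⟨p, hl, hs⟩ := ih fun i hi => hadj i (by omega)
    refine ⟨p.concat (hadj m (by omega)), by simp [hl], ?_⟩
    rw [Walk.support_concat, hs, List.range_succ (n := m + 1)]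
    simp

/-- A sequence of distinct vertices with consecutive terms adjacent, whose two ends are adjacent
to a vertex `x` off the sequence, closes up through `x` to a cycle. -/
theorem exists_isCycle_through {V : Type*} {G : SimpleGraph V} (h : ℕ → V) (m : ℕ) (hm : 1 ≤ m)
    (hadj : ∀ i < m, G.Adj (h i) (h (i + 1)))
    (hinj : ∀ i ≤ m, ∀ j ≤ m, h i = h j → i = j) (x : V) (hx : ∀ i ≤ m, h i ≠ x)
    (h0 : G.Adj x (h 0)) (hlast : G.Adj x (h m)) :
    ∃ (u : V) (D : G.Walk u u), D.IsCycle ∧ D.length = m + 2 := by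
  obtain ⟨p, hl, hs⟩ := exists_walk_support_eq_map_range h m hadj
  have hp : p.IsPath := by
    rw [Walk.isPath_def, hs]
    refine List.Nodup.map_on ?_ List.nodup_range
    intro i hi j hj hij
    rw [List.mem_range] at hi hj
    exact hinj i (by omega) j (by omega) hij
  have hxp : x ∉ p.support := by
    rw [hs, List.mem_map]
    rintro ⟨i, hi, hix⟩
    rw [List.mem_range] at hi
    exact hx i (by omega) hix
  refine ⟨_, Walk.cons hlast.symm (Walk.cons h0 p), ?_, by simp [hl]⟩
  rw [Walk.cons_isCycle_iff, Walk.cons_isPath_iff, Walk.edges_cons, List.mem_cons]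
  refine ⟨⟨hp, hxp⟩, ?_⟩
  rintro (he | he)
  · rw [Sym2.eq_iff] at he
    rcases he with ⟨he, -⟩ | ⟨he, -⟩
    · exact hx m le_rfl he
    · have := hinj m le_rfl 0 (by omega) he
      omega
  · exact hxp (p.snd_mem_support_of_mem_edges he)

set_option maxHeartbeats 1000000 in
/-- Let `f 0, …, f (n - 1)` run once around a cycle, let `x` be a vertex off it adjacent to `f 0`,
`f j` and `f k` with `j ≤ k`, and let `f (j - 1)` be adjacent to `f (k + 1)`. If a neighbour of
`f 0` on the cycle is adjacent to `f j` or to `f k`, then there is a cycle longer by one. -/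
theorem exists_isCycle_length_succ {V : Type*} {G : SimpleGraph V} (f : ℕ → V) (n : ℕ) (hn : 3 ≤ n)
    (hadj : ∀ i, i + 1 < n → G.Adj (f i) (f (i + 1))) (hclose : G.Adj (f (n - 1)) (f 0))
    (hinj : ∀ i < n, ∀ j < n, f i = f j → i = j) (x : V) (hx : ∀ i < n, f i ≠ x)
    (j k : ℕ) (hj : j ≠ 0) (hjk : j ≤ k) (hk : k < n)
    (h0 : G.Adj x (f 0)) (hxj : G.Adj x (f j)) (hxk : G.Adj x (f k))
    (hchord : G.Adj (f (j - 1)) (f (k + 1)))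
    (hend : G.Adj (f 1) (f j) ∨ G.Adj (f (n - 1)) (f j) ∨
      G.Adj (f 1) (f k) ∨ G.Adj (f (n - 1)) (f k)) :
    ∃ (u : V) (D : G.Walk u u), D.IsCycle ∧ D.length = n + 1 := by
  have reorder (g : ℕ → ℕ) (hg : ∀ i < n, g i < n)
      (hginj : ∀ i < n, ∀ i' < n, g i = g i' → i = i')
      (hgadj : ∀ i, i + 1 < n → G.Adj (f (g i)) (f (g (i + 1))))
      (hg0 : G.Adj x (f (g 0))) (hglast : G.Adj x (f (g (n - 1)))) :
      ∃ (u : V) (D : G.Walk u u), D.IsCycle ∧ D.length = n + 1 := by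
    obtain ⟨u, D, hD, hl⟩ := exists_isCycle_through (fun i => f (g i)) (n - 1) (by omega)
      (fun i hi => hgadj i (by omega))
      (fun i hi i' hi' h => hginj i (by omega) i' (by omega)
        (hinj _ (hg i (by omega)) _ (hg i' (by omega)) h))
      x (fun i hi => hx _ (hg i (by omega))) hg0 hglast
    exact ⟨u, D, hD, by omega⟩
  have step (p q : ℕ) (hp : p < n) (hq : q < n)
      (h : q = p + 1 ∨ p = q + 1 ∨ (p = 0 ∧ q = n - 1) ∨ (p = n - 1 ∧ q = 0)) :
      G.Adj (f p) (f q) := by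
    rcases h with rfl | rfl | ⟨rfl, rfl⟩ | ⟨rfl, rfl⟩
    · exact hadj p hq
    · exact (hadj q hp).symm
    · exact hclose.symm
    · exact hclose
  by_cases hj1 : j = 1
  · subst hj1
    refine reorder (fun i => if i = n - 1 then 0 else i + 1) ?_ ?_ ?_ ?_ ?_
    · intro i hi
      split_ifs <;> omega
    · intro i hi i' hi' h
      split_ifs at h <;> omega
    · intro i hi
      apply step <;> split_ifs <;> omega
    · simpa [show 0 ≠ n - 1 by omega] using hxj
    · simpa using h0
  by_cases hkn : k = n - 1
  · subst hkn
    exact reorder id (fun i hi => hi) (fun _ _ _ _ h => h) hadj h0 hxk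
  rcases hend with hend | hend | hend | hend
  · refine reorder (fun i => if i = 0 then 0 else if i < n - k then n - i
      else if i < n - k + j - 1 then n - k + j - 1 - i else i - (n - k - 1)) ?_ ?_ ?_ ?_ ?_
    · intro i hi
      split_ifs <;> omega
    · intro i hi i' hi' h
      split_ifs at h <;> omega
    · intro i hi
      have join (p q : ℕ) (hp : p < n) (hq : q < n) (h : q = p + 1 ∨ p = q + 1 ∨
          (p = 0 ∧ q = n - 1) ∨ (p = k + 1 ∧ q = j - 1) ∨ (p = 1 ∧ q = j)) :
          G.Adj (f p) (f q) := by
        rcases h with h | h | h | ⟨rfl, rfl⟩ | ⟨rfl, rfl⟩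
        · exact step p q hp hq (by omega)
        · exact step p q hp hq (by omega)
        · exact step p q hp hq (by omega)
        · exact hchord.symm
        · exact hend
      apply join <;> split_ifs <;> first | contradiction | omega
    · convert h0 using 2
      split_ifs <;> omega
    · convert hxk using 2
      split_ifs <;> omega
  · refine reorder (fun i => if i < j then i else if i < j + n - 1 - k then i - j + k + 1
      else i - (n - 1 - k)) ?_ ?_ ?_ ?_ ?_
    · intro i hi
      split_ifs <;> omega
    · intro i hi i' hi' h
      split_ifs at h <;> omega
    · intro i hi
      have join (p q : ℕ) (hp : p < n) (hq : q < n) (h : q = p + 1 ∨ p = q + 1 ∨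
          (p = 0 ∧ q = n - 1) ∨ (p = j - 1 ∧ q = k + 1) ∨ (p = n - 1 ∧ q = j)) :
          G.Adj (f p) (f q) := by
        rcases h with h | h | h | ⟨rfl, rfl⟩ | ⟨rfl, rfl⟩
        · exact step p q hp hq (by omega)
        · exact step p q hp hq (by omega)
        · exact step p q hp hq (by omega)
        · exact hchord
        · exact hend
      apply join <;> split_ifs <;> first | contradiction | omega
    · convert h0 using 2
      split_ifs <;> omega
    · convert hxk using 2
      split_ifs <;> omega
  · refine reorder (fun i => if i = 0 then 0 else if i < n - k then n - i
      else if i < n - k + j - 1 then n - k + j - 1 - i else n - 1 + j - i) ?_ ?_ ?_ ?_ ?_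
    · intro i hi
      split_ifs <;> omega
    · intro i hi i' hi' h
      split_ifs at h <;> omega
    · intro i hi
      have join (p q : ℕ) (hp : p < n) (hq : q < n) (h : q = p + 1 ∨ p = q + 1 ∨
          (p = 0 ∧ q = n - 1) ∨ (p = k + 1 ∧ q = j - 1) ∨ (p = 1 ∧ q = k)) :
          G.Adj (f p) (f q) := by
        rcases h with h | h | h | ⟨rfl, rfl⟩ | ⟨rfl, rfl⟩
        · exact step p q hp hq (by omega)
        · exact step p q hp hq (by omega)
        · exact step p q hp hq (by omega)
        · exact hchord.symm
        · exact hend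
      apply join <;> split_ifs <;> first | contradiction | omega
    · convert h0 using 2
      split_ifs <;> omega
    · convert hxj using 2
      split_ifs <;> omega
  · refine reorder (fun i => if i < j then i else if i < j + n - 1 - k then i - j + k + 1
      else j + n - 1 - i) ?_ ?_ ?_ ?_ ?_
    · intro i hi
      split_ifs <;> omega
    · intro i hi i' hi' h
      split_ifs at h <;> omega
    · intro i hi
      have join (p q : ℕ) (hp : p < n) (hq : q < n) (h : q = p + 1 ∨ p = q + 1 ∨
          (p = 0 ∧ q = n - 1) ∨ (p = j - 1 ∧ q = k + 1) ∨ (p = n - 1 ∧ q = k)) :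
          G.Adj (f p) (f q) := by
        rcases h with h | h | h | ⟨rfl, rfl⟩ | ⟨rfl, rfl⟩
        · exact step p q hp hq (by omega)
        · exact step p q hp hq (by omega)
        · exact step p q hp hq (by omega)
        · exact hchord
        · exact hend
      apply join <;> split_ifs <;> first | contradiction | omega
    · convert h0 using 2
      split_ifs <;> omega
    · convert hxj using 2
      split_ifs <;> omega

/-- Let `C` be a longest cycle of `L` and `x` a vertex off `C` all of whose neighbours
lie on `C`. Let `x_i = C.getVert a`, `x_j = C.getVert b` and `x_k = C.getVert c` be
neighbours of `x` such that, traversing `C` from `x_i` along the orientation, `x_j` is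
met no later than `x_k` (and `x_i ≠ x_j`, `x_i ≠ x_k`). Then either none of
`x_i⁺x_j`, `x_i⁻x_j`, `x_i⁺x_k`, `x_i⁻x_k` is an edge, or `x_j⁻x_k⁺` is not an edge. -/
theorem longest_cycle_common_arg {V : Type*} [Fintype V] (L : SimpleGraph V)
    {v : V} (C : L.Walk v v) (hC : C.IsCycle)
    (hmax : ∀ (u : V) (D : L.Walk u u), D.IsCycle → D.length ≤ C.length)
    (x : V) (hx : x ∉ C.support) (hnbrs : ∀ w : V, L.Adj x w → w ∈ C.support)
    (a b c : ℕ) (ha : a < C.length) (hb : b < C.length) (hc : c < C.length)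
    (hxa : L.Adj x (C.getVert a)) (hxb : L.Adj x (C.getVert b))
    (hxc : L.Adj x (C.getVert c))
    (hab : (b + C.length - a) % C.length ≠ 0)
    (hac : (c + C.length - a) % C.length ≠ 0)
    (horder : (b + C.length - a) % C.length ≤ (c + C.length - a) % C.length) :
    (¬ L.Adj (cycSucc C a) (C.getVert b) ∧ ¬ L.Adj (cycPred C a) (C.getVert b) ∧
     ¬ L.Adj (cycSucc C a) (C.getVert c) ∧ ¬ L.Adj (cycPred C a) (C.getVert c)) ∨
    ¬ L.Adj (cycPred C b) (cycSucc C c) := by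
  have hn := hC.three_le_length
  have hpos (b : ℕ) (hb : b < C.length) :
      (a + (b + C.length - a) % C.length) % C.length = b := by
    rw [Nat.add_mod_mod, show a + (b + C.length - a) = b + C.length by omega, Nat.add_mod_right,
      Nat.mod_eq_of_lt hb]
  set n := C.length with hn_def
  set j := (b + n - a) % n with hj_def
  set k := (c + n - a) % n with hk_def
  have hk : k < n := Nat.mod_lt _ (by omega)
  have hlt (i : ℕ) : i % n < n := Nat.mod_lt _ (by omega)
  have hsucc (i : ℕ) : C.getVert ((i + 1) % n) = C.getVert (i % n + 1) := by
    rcases Nat.lt_or_ge (i % n + 1) n with h | h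
    · rw [Nat.add_mod, Nat.mod_eq_of_lt (by omega : 1 < n), Nat.mod_eq_of_lt h]
    · have h' : i % n + 1 = n := by have := hlt i; omega
      rw [Nat.add_mod, Nat.mod_eq_of_lt (by omega : 1 < n), h', Nat.mod_self, hn_def,
        C.getVert_length, C.getVert_zero]
  have hadj (i : ℕ) : L.Adj (C.getVert ((a + i) % n)) (C.getVert ((a + (i + 1)) % n)) := by
    rw [← Nat.add_assoc, hsucc]
    exact C.adj_getVert_succ (hlt _)
  have hinj (i : ℕ) (hi : i < n) (i' : ℕ) (hi' : i' < n)
      (h : C.getVert ((a + i) % n) = C.getVert ((a + i') % n)) : i = i' := by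
    have hmod : (a + i) % n = (a + i') % n :=
      hC.getVert_injOn' (Nat.le_sub_one_of_lt (hlt _)) (Nat.le_sub_one_of_lt (hlt _)) h
    exact (Nat.ModEq.add_left_cancel' a hmod).eq_of_lt_of_lt hi hi'
  have hxne (i : ℕ) (_ : i < n) : C.getVert ((a + i) % n) ≠ x := by
    rintro rfl
    exact hx (C.getVert_mem_support _)
  have hclose : L.Adj (C.getVert ((a + (n - 1)) % n)) (C.getVert ((a + 0) % n)) := by
    have h := hadj (n - 1)
    rwa [show a + (n - 1 + 1) = a + 0 + n by omega, Nat.add_mod_right] at h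
  have ha0 : (a + 0) % n = a := Nat.mod_eq_of_lt ha
  have hpred_a : cycPred C a = C.getVert ((a + (n - 1)) % n) := by
    rw [cycPred, ← hn_def, show a + n - 1 = a + (n - 1) by omega]
  have hpred_b : cycPred C b = C.getVert ((a + (j - 1)) % n) := by
    rw [cycPred, ← hn_def, show b + n - 1 = b + (n - 1) by omega]
    conv_lhs => rw [← hpos b hb]
    rw [Nat.mod_add_mod, ← hj_def, show a + j + (n - 1) = a + (j - 1) + n by omega,
      Nat.add_mod_right]
  have hsucc_c : cycSucc C c = C.getVert ((a + (k + 1)) % n) := by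
    rw [cycSucc, ← hn_def]
    conv_lhs => rw [← hpos c hc]
    rw [Nat.mod_add_mod, ← hk_def, Nat.add_assoc]
  by_contra hcon
  rw [not_or, not_not, hpred_a, hpred_b, hsucc_c] at hcon
  obtain ⟨hend, hchord⟩ := hcon
  obtain ⟨u, D, hD, hl⟩ := exists_isCycle_length_succ (fun i => C.getVert ((a + i) % n)) n hn
    (fun i _ => hadj i) hclose hinj x hxne j k hab horder hk
    (by simpa only [ha0] using hxa) (by simpa only [hj_def, hpos b hb] using hxb)
    (by simpa only [hk_def, hpos c hc] using hxc) hchord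
    (by
      simp only [hj_def, hk_def, hpos b hb, hpos c hc]
      rw [cycSucc, ← hn_def] at hend
      tauto)
  have := hmax u D hD
  omega
end

section
/- Let G be a finite simple graph whose coline graph L = co(G) is tough, and let C be a longest cycle of L. Then every connected component of L − V(C) consists of a single vertex. -/
open SimpleGraph

namespace SimpleGraph

variable {W : Type*} {L : SimpleGraph W}

theorem Walk.exists_eq_append_cons_of_mem_darts {u v : W} (p : L.Walk u v) {d : L.Dart}
    (hd : d ∈ p.darts) :
    ∃ (q : L.Walk u d.fst) (r : L.Walk d.snd v), p = q.append (Walk.cons d.adj r) := by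
  induction p with
  | nil => simp at hd
  | cons h p ih =>
    rw [Walk.darts_cons, List.mem_cons] at hd
    rcases hd with rfl | hd
    · exact ⟨Walk.nil, p, rfl⟩
    · obtain ⟨q, r, rfl⟩ := ih hd
      exact ⟨Walk.cons h q, r, rfl⟩

theorem Walk.IsPath.append_cons {a b c d : W} {p : L.Walk a b} {q : L.Walk c d}
    (hp : p.IsPath) (hq : q.IsPath) (h : L.Adj b c)
    (hdisj : ∀ x ∈ p.support, x ∉ q.support) : (p.append (Walk.cons h q)).IsPath := by
  rw [Walk.isPath_def, Walk.support_append, Walk.support_cons, List.tail_cons,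
    List.nodup_append']
  exact ⟨hp.support_nodup, hq.support_nodup, fun x hx hx' => hdisj x hx hx'⟩

/-- Deleting a dart from a cycle leaves a path from the head to the tail of the dart. -/
theorem Walk.IsCycle.exists_isPath_of_mem_darts {v : W} {C : L.Walk v v} (hC : C.IsCycle)
    {d : L.Dart} (hd : d ∈ C.darts) :
    ∃ p : L.Walk d.snd d.fst, p.IsPath ∧ p.length + 1 = C.length ∧
      (∀ x, x ∈ p.support ↔ x ∈ C.support) ∧ ∀ e ∈ C.darts, e ≠ d → e ∈ p.darts := by
  obtain ⟨q, r, rfl⟩ := C.exists_eq_append_cons_of_mem_darts hd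
  refine ⟨r.append q, ?_, ?_, ?_, ?_⟩
  · have h := hC.support_nodup
    rw [Walk.tail_support_append, Walk.support_cons, List.tail_cons] at h
    rw [Walk.isPath_def, Walk.support_append]
    exact List.perm_append_comm.nodup h
  · simp only [Walk.length_append, Walk.length_cons]; omega
  · intro x
    have := q.end_mem_support
    simp only [Walk.mem_support_append_iff, Walk.support_cons, List.mem_cons]
    grind
  · intro e he hne
    simp only [Walk.darts_append, Walk.darts_cons, List.mem_append, List.mem_cons] at he ⊢
    tauto

theorem Walk.IsCycle.exists_mem_darts_fst {v : W} {C : L.Walk v v} (hC : C.IsCycle) {x : W}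
    (hx : x ∈ C.support) : ∃ d ∈ C.darts, d.fst = x := by
  have hx' : x ∈ C.support.dropLast := by
    rw [← C.tail_support_perm_dropLast_support.mem_iff]
    rw [Walk.mem_support_iff] at hx
    rcases hx with rfl | hx
    · exact C.end_mem_tail_support hC.not_nil
    · exact hx
  rwa [← Walk.map_fst_darts, List.mem_map] at hx'

theorem Walk.IsCycle.dart_eq_of_snd_eq {v : W} {C : L.Walk v v} (hC : C.IsCycle)
    {d e : L.Dart} (hd : d ∈ C.darts) (he : e ∈ C.darts) (h : d.snd = e.snd) : d = e := by
  have hn := hC.support_nodup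
  rw [← Walk.map_snd_darts] at hn
  exact List.inj_on_of_nodup_map hn hd he h

section LongestCycle

variable {v : W} {C : L.Walk v v}

theorem Walk.IsPath.length_lt_of_longest_cycle
    (hmax : ∀ (u : W) (D : L.Walk u u), D.IsCycle → D.length ≤ C.length)
    {a b : W} {p : L.Walk a b} (hp : p.IsPath) (h : L.Adj b a) (hlen : 2 ≤ p.length) :
    p.length + 1 ≤ C.length := by
  refine hmax b (Walk.cons h p) ?_
  rw [Walk.isCycle_iff_isPath_tail_and_le_length]
  exact ⟨by simpa using hp, by simpa using hlen⟩

/-- A path outside a longest cycle cannot be inserted between the ends of a dart. -/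
theorem Walk.IsCycle.not_adj_snd_of_longest (hC : C.IsCycle)
    (hmax : ∀ (u : W) (D : L.Walk u u), D.IsCycle → D.length ≤ C.length)
    {d : L.Dart} (hd : d ∈ C.darts) {g h : W} {P : L.Walk g h} (hP : P.IsPath)
    (hPC : ∀ w ∈ P.support, w ∉ C.support) (hg : L.Adj d.fst g) : ¬ L.Adj h d.snd := by
  intro hh
  obtain ⟨p, hp, hlen, hsupp, -⟩ := hC.exists_isPath_of_mem_darts hd
  have h3 := hC.three_le_length
  have hQ := hp.append_cons hP hg fun x hx hx' => hPC x hx' ((hsupp x).1 hx)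
  have := hQ.length_lt_of_longest_cycle hmax hh
  simp only [Walk.length_append, Walk.length_cons] at this
  omega

/-- If a path outside a longest cycle joins neighbours of two vertices of the cycle, then the
successors of these two vertices are not adjacent. -/
theorem Walk.IsCycle.not_adj_snd_snd_of_longest (hC : C.IsCycle)
    (hmax : ∀ (u : W) (D : L.Walk u u), D.IsCycle → D.length ≤ C.length)
    {d e : L.Dart} (hd : d ∈ C.darts) (he : e ∈ C.darts) (hne : e ≠ d)
    {g h : W} {P : L.Walk g h} (hP : P.IsPath)
    (hPC : ∀ w ∈ P.support, w ∉ C.support) (hg : L.Adj e.fst g) (hh : L.Adj h d.fst) :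
    ¬ L.Adj e.snd d.snd := by
  intro hadj
  obtain ⟨p, hp, hlen, hsupp, hdarts⟩ := hC.exists_isPath_of_mem_darts hd
  obtain ⟨q, r, rfl⟩ := p.exists_eq_append_cons_of_mem_darts (hdarts e he hne)
  have h3 := hC.three_le_length
  have hn := hp.support_nodup
  rw [Walk.support_append, Walk.support_cons, List.tail_cons, List.nodup_append'] at hn
  have hs : ∀ x, x ∈ q.support ∨ x ∈ r.support → x ∈ C.support := by
    intro x hx
    rw [← hsupp, Walk.mem_support_append_iff, Walk.support_cons, List.mem_cons]
    tauto
  have hr : r.reverse.IsPath := (Walk.IsPath.mk' hn.2.1).reverse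
  have hPr := hP.append_cons hr hh fun x hx hx' => hPC x hx (hs x (by simp_all))
  have hQ := (Walk.IsPath.mk' hn.1).append_cons hPr hg (by
    intro x hx hx'
    have h1 := hs x (.inl hx)
    have h2 : x ∉ r.support := fun h => hn.2.2 hx h
    have h4 : x ∉ P.support := fun h => hPC x h h1
    simp only [Walk.support_append, Walk.support_cons, List.tail_cons, List.mem_append,
      Walk.support_reverse, List.mem_reverse] at hx'
    tauto)
  have := hQ.length_lt_of_longest_cycle hmax hadj
  simp only [Walk.length_append, Walk.length_cons, Walk.length_reverse] at this hlen
  omega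

end LongestCycle

theorem Reachable.exists_isPath_of_induce {s : Set W} {g h : s}
    (hr : (L.induce s).Reachable g h) :
    ∃ P : L.Walk g h, P.IsPath ∧ ∀ w ∈ P.support, w ∈ s := by
  obtain ⟨p, hp⟩ := hr.exists_isPath
  let φ : L.induce s ↪g L := Embedding.induce s
  have h' : ∀ w ∈ (p.map φ.toHom).support, w ∈ s := by
    intro w hw
    rw [Walk.support_map, List.mem_map] at hw
    obtain ⟨x, -, rfl⟩ := hw
    exact x.2
  exact ⟨p.map φ.toHom, hp.map φ.injective, h'⟩

theorem Reachable.mem_of_closed {s : Set W}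
    (hs : ∀ x y, L.Adj x y → x ∈ s → y ∈ s) {x y : W} (h : L.Reachable x y) (hx : x ∈ s) :
    y ∈ s := by
  obtain ⟨p⟩ := h
  induction p with
  | nil => exact hx
  | cons hadj _ ih => exact ih (hs _ _ hadj hx)

end SimpleGraph

/-- In a tough graph, no edge `ab` disjoint from a longest cycle is such that adjacency among
the further vertices adjacent to neither `a` nor `b` is a matching. -/
theorem IsTough.false_of_longest_cycle {W : Type*} [Finite W] {L : SimpleGraph W}
    (htough : IsTough L) {v : W} {C : L.Walk v v} (hC : C.IsCycle)
    (hmax : ∀ (u : W) (D : L.Walk u u), D.IsCycle → D.length ≤ C.length)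
    {a b : W} (hab : L.Adj a b) (ha : a ∉ C.support) (hb : b ∉ C.support)
    (hmatch : ∀ e f g, (∀ x ∈ ({e, f, g} : Set W), x ≠ a ∧ x ≠ b ∧ ¬ L.Adj a x ∧ ¬ L.Adj b x) →
      L.Adj e f → L.Adj f g → e = g) : False := by
  set T : Set W := {w | w ∉ C.support} with hT
  set H : Set W := {w | ∃ hw : w ∈ T, (L.induce T).Reachable ⟨a, ha⟩ ⟨w, hw⟩} with hH
  set S : Set W := {x | x ∈ C.support ∧ ∃ h ∈ H, L.Adj h x} with hS
  have haH : a ∈ H := ⟨ha, .rfl⟩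
  have hstep : ∀ x ∈ H, ∀ y, L.Adj x y → y ∈ S ∨ y ∈ H := by
    rintro x ⟨hx, hr⟩ y hxy
    by_cases hy : y ∈ C.support
    · exact .inl ⟨hy, x, ⟨hx, hr⟩, hxy⟩
    · exact .inr ⟨hy, hr.trans (Adj.reachable (G := L.induce T) (u := ⟨x, hx⟩) (v := ⟨y, hy⟩) hxy)⟩
  have hbH : b ∈ H := (hstep a haH b hab).resolve_left fun h => hb h.1
  have hpath : ∀ g ∈ H, ∀ h ∈ H, ∃ P : L.Walk g h, P.IsPath ∧ ∀ w ∈ P.support, w ∉ C.support := by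
    rintro g ⟨hg, hrg⟩ h ⟨hh, hrh⟩
    exact (hrg.symm.trans hrh).exists_isPath_of_induce
  have hdart : ∀ x : S, ∃ d ∈ C.darts, d.fst = x := fun x => hC.exists_mem_darts_fst x.2.1
  choose d hdC hdx using hdart
  have hd_inj : Function.Injective d := by
    intro x y hxy
    rw [Subtype.ext_iff, ← hdx, ← hdx, hxy]
  have hsndC : ∀ x, (d x).snd ∈ C.support := fun x =>
    C.dart_snd_mem_support_of_mem_darts (hdC x)
  have hsndH : ∀ x, (d x).snd ∉ H := fun x h => h.1 (hsndC x)
  have hsndS : ∀ x, (d x).snd ∉ S := by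
    rintro x ⟨-, h, hhH, hadj⟩
    obtain ⟨-, g, hgH, hgx⟩ := x.2
    obtain ⟨P, hP, hPC⟩ := hpath g hgH h hhH
    exact hC.not_adj_snd_of_longest hmax (hdC x) hP hPC (hdx x ▸ hgx.symm) hadj
  have hindep : ∀ x y, x ≠ y → ¬ L.Adj (d x).snd (d y).snd := by
    intro x y hxy
    obtain ⟨-, g, hgH, hgx⟩ := x.2
    obtain ⟨-, h, hhH, hhy⟩ := y.2
    obtain ⟨P, hP, hPC⟩ := hpath g hgH h hhH
    exact hC.not_adj_snd_snd_of_longest hmax (hdC y) (hdC x) (hd_inj.ne hxy) hP hPC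
      (hdx x ▸ hgx.symm) (hdx y ▸ hhy)
  have hfar : ∀ x, x ∉ S → x ∉ H → x ≠ a ∧ x ≠ b ∧ ¬ L.Adj a x ∧ ¬ L.Adj b x := by
    intro x hxS hxH
    refine ⟨?_, ?_, fun h => ?_, fun h => ?_⟩
    · rintro rfl; exact hxH haH
    · rintro rfl; exact hxH hbH
    · exact (hstep a haH x h).elim hxS hxH
    · exact (hstep b hbH x h).elim hxS hxH
  have hcl_H : ∀ x y : ↥Sᶜ, (L.induce Sᶜ).Adj x y → x ∈ {z : ↥Sᶜ | z.1 ∈ H} →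
      y ∈ {z : ↥Sᶜ | z.1 ∈ H} := fun x y hxy hx => (hstep x hx y hxy).resolve_left y.2
  have haS : a ∈ Sᶜ := fun h => ha h.1
  let c : Option S → (L.induce Sᶜ).ConnectedComponent := fun o =>
    o.elim ((L.induce Sᶜ).connectedComponentMk ⟨a, haS⟩)
      fun x => (L.induce Sᶜ).connectedComponentMk ⟨(d x).snd, hsndS x⟩
  have hnone : ∀ x, c none ≠ c (some x) := fun x h =>
    hsndH x ((ConnectedComponent.exact h).mem_of_closed hcl_H haH)
  have hc : Function.Injective c := by
    rintro (_ | x) (_ | y) hxy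
    · rfl
    · exact (hnone y hxy).elim
    · exact (hnone x hxy.symm).elim
    · by_contra hne
      have hne : x ≠ y := fun h => hne (h ▸ rfl)
      have hr := ConnectedComponent.exact hxy
      have := hr.mem_of_closed
        (s := {z : ↥Sᶜ | z.1 ∉ H ∧ (z.1 = (d x).snd ∨ L.Adj (d x).snd z.1)}) (by
          rintro z w hzw ⟨hzH, hz⟩
          have hwH : w.1 ∉ H := fun h => hzH (hcl_H w z hzw.symm h)
          refine ⟨hwH, ?_⟩
          rcases hz with hz | hz
          · exact .inr (hz ▸ hzw)
          · refine .inl (hmatch _ z.1 w.1 ?_ hz hzw).symm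
            rintro t (rfl | rfl | rfl)
            exacts [hfar _ (hsndS x) (hsndH x), hfar _ z.2 hzH, hfar _ w.2 hwH])
        ⟨hsndH x, .inl rfl⟩
      rcases this.2 with h | h
      · exact hne (hd_inj (hC.dart_eq_of_snd_eq (hdC y) (hdC x) h)).symm
      · exact hindep x y hne h
  have hnc : ¬ (L.induce Sᶜ).Connected := by
    intro hcon
    have hv : v ∈ S := by
      by_contra hv
      exact ((hcon.preconnected ⟨a, haS⟩ ⟨v, hv⟩).mem_of_closed hcl_H haH).1 C.start_mem_support
    exact hnone ⟨v, hv⟩ (ConnectedComponent.sound (hcon.preconnected _ _))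
  have hle := (Nat.card_le_card_of_injective c hc).trans (htough S hnc)
  rw [Finite.card_option] at hle
  omega

theorem coline_adj_iff {V : Type*} {G : SimpleGraph V} {e f : G.edgeSet} :
    (coline G).Adj e f ↔ ∀ x ∈ (e : Sym2 V), x ∉ (f : Sym2 V) := by
  rw [coline, compl_adj, lineGraph_adj_iff_exists]
  constructor
  · rintro ⟨hne, h⟩ x hx hx'
    exact h ⟨hne, x, hx, hx'⟩
  · intro h
    refine ⟨?_, fun ⟨_, x, hx, hx'⟩ => h x hx hx'⟩
    rintro rfl
    exact h _ (Sym2.out_fst_mem _) (Sym2.out_fst_mem _)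

/-- Among the edges meeting both of two disjoint edges, disjointness is a matching. -/
theorem coline_eq_of_adj_of_adj {V : Type*} {G : SimpleGraph V} {a b e f g : G.edgeSet}
    (hab : (coline G).Adj a b)
    (h : ∀ x ∈ ({e, f, g} : Set G.edgeSet), ¬ (coline G).Adj a x ∧ ¬ (coline G).Adj b x)
    (hef : (coline G).Adj e f) (hfg : (coline G).Adj f g) : e = g := by
  have key : ∀ x ∈ ({e, f, g} : Set G.edgeSet),
      ∃ p q, p ∈ (a : Sym2 V) ∧ q ∈ (b : Sym2 V) ∧ (x : Sym2 V) = s(p, q) := by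
    intro x hx
    obtain ⟨ha, hb⟩ := h x hx
    simp only [coline_adj_iff, not_forall, not_not] at ha hb
    obtain ⟨p, hpa, hpx⟩ := ha
    obtain ⟨q, hqb, hqx⟩ := hb
    refine ⟨p, q, hpa, hqb, (Sym2.mem_and_mem_iff ?_).1 ⟨hpx, hqx⟩⟩
    rintro rfl
    exact coline_adj_iff.1 hab p hpa hqb
  obtain ⟨p, q, hpa, hqb, he⟩ := key e (by simp)
  obtain ⟨r, s, hra, hsb, hf⟩ := key f (by simp)
  obtain ⟨t, u, hta, hub, hg⟩ := key g (by simp)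
  have hother : ∀ (z : Sym2 V) (x y w : V), x ∈ z → y ∈ z → w ∈ z → x ≠ y → w ≠ y → x = w := by
    intro z x y w hx hy hw hxy hwy
    rw [(Sym2.mem_and_mem_iff hxy).1 ⟨hx, hy⟩, Sym2.mem_iff] at hw
    exact (hw.resolve_right hwy).symm
  simp only [coline_adj_iff, he, hf, hg, Sym2.mem_iff] at hef hfg
  have hpt : p = t := hother a p r t hpa hra hta (by grind) (by grind)
  have hqu : q = u := hother b q s u hqb hsb hub (by grind) (by grind)
  exact Subtype.ext (by rw [he, hg, hpt, hqu])

/-- If the coline graph `L` of `G` is tough and `C` is a longest cycle of `L`, then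
every connected component of `L - V(C)` consists of a single vertex. -/
theorem tough_coline_components_trivial {V : Type*} [Fintype V] [DecidableEq V]
    (G : SimpleGraph V) [DecidableRel G.Adj] (htough : IsTough (coline G))
    {v : G.edgeSet} (C : (coline G).Walk v v) (hC : C.IsCycle)
    (hmax : ∀ (u : G.edgeSet) (D : (coline G).Walk u u), D.IsCycle → D.length ≤ C.length) :
    ∀ a b : {w | w ∉ C.support},
      ((coline G).induce {w | w ∉ C.support}).Reachable a b → a = b := by
  rintro a b ⟨p⟩
  cases p with
  | nil => rfl
  | @cons _ w _ h _ =>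
    exact (htough.false_of_longest_cycle hC hmax h a.2 w.2 fun e f g hfar hef hfg =>
      coline_eq_of_adj_of_adj h (fun x hx => (hfar x hx).2.2) hef hfg).elim
end

section
/- None of the coline graphs co(H1), co(H2) and co(H3) is Hamiltonian. -/
open SimpleGraph

/-- `H1`: the net together with an edge joining two of its pendant vertices. -/
def H1 : SimpleGraph (Fin 6) :=
  SimpleGraph.fromEdgeSet {s(0, 1), s(0, 2), s(1, 2), s(0, 3), s(1, 4), s(2, 5), s(3, 4)}

/-- `H2`: the net together with a new vertex adjacent to exactly one pendant vertex. -/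
def H2 : SimpleGraph (Fin 7) :=
  SimpleGraph.fromEdgeSet {s(0, 1), s(0, 2), s(1, 2), s(0, 3), s(1, 4), s(2, 5), s(3, 6)}

/-- `H3`: the disjoint union of the net and a single edge. -/
def H3 : SimpleGraph (Fin 8) :=
  SimpleGraph.fromEdgeSet {s(0, 1), s(0, 2), s(1, 2), s(0, 3), s(1, 4), s(2, 5), s(6, 7)}

noncomputable instance : Fintype H1.edgeSet := Fintype.ofFinite _
noncomputable instance : Fintype H2.edgeSet := Fintype.ofFinite _
noncomputable instance : Fintype H3.edgeSet := Fintype.ofFinite _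

/-- In a Hamiltonian cycle, a vertex with at most the two neighbours `u` and `g` uses the edge
to `g`. -/
lemma SimpleGraph.Walk.IsHamiltonianCycle.toSubgraph_adj_of_neighborSet_subset {V : Type*}
    [DecidableEq V] {G : SimpleGraph V} {r : V} {p : G.Walk r r} (hp : p.IsHamiltonianCycle)
    {v u g : V} (h : G.neighborSet v ⊆ {u, g}) : p.toSubgraph.Adj g v := by
  have hcard := hp.isCycle.ncard_neighborSet_toSubgraph_eq_two (hp.mem_support v)
  have hsub : p.toSubgraph.neighborSet v ⊆ {u, g} :=
    (p.toSubgraph.neighborSet_subset v).trans h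
  have heq := Set.eq_of_subset_of_ncard_le hsub
    (hcard ▸ (Set.ncard_insert_le u {g}).trans_eq (by rw [Set.ncard_singleton]))
  have hg : g ∈ p.toSubgraph.neighborSet v := heq ▸ Set.mem_insert_of_mem u rfl
  exact p.toSubgraph.adj_symm hg

/-- A graph in which three distinct vertices of degree at most two share a neighbour is not
Hamiltonian. -/
lemma SimpleGraph.not_isHamiltonian_of_three_neighborSet_subset {V : Type*} [DecidableEq V]
    [Fintype V] {G : SimpleGraph V} {x y z u v w g : V} (hxy : x ≠ y) (hxz : x ≠ z) (hyz : y ≠ z)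
    (hx : G.neighborSet x ⊆ {u, g}) (hy : G.neighborSet y ⊆ {v, g})
    (hz : G.neighborSet z ⊆ {w, g}) : ¬ G.IsHamiltonian := by
  intro hG
  have : Nontrivial V := ⟨x, y, hxy⟩
  obtain ⟨r, p, hp⟩ := hG Fintype.one_lt_card.ne'
  have hcard := hp.isCycle.ncard_neighborSet_toSubgraph_eq_two (hp.mem_support g)
  have hsub : ({x, y, z} : Set V) ⊆ p.toSubgraph.neighborSet g := by
    rintro _ (rfl | rfl | rfl)
    exacts [hp.toSubgraph_adj_of_neighborSet_subset hx,
      hp.toSubgraph_adj_of_neighborSet_subset hy, hp.toSubgraph_adj_of_neighborSet_subset hz]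
  have hle := Set.ncard_le_ncard hsub (Set.toFinite _)
  rw [Set.ncard_eq_three.mpr ⟨x, y, z, hxy, hxz, hyz, rfl⟩, hcard] at hle
  omega

/-- Two edges of a coline graph are adjacent only if they have no common endpoint. -/
lemma not_mem_of_coline_adj {V : Type*} {G : SimpleGraph V} {e f : G.edgeSet}
    (h : (coline G).Adj e f) {v : V} (hv : v ∈ (e : Sym2 V)) : v ∉ (f : Sym2 V) := by
  intro hf
  rw [coline, compl_adj, lineGraph_adj_iff_exists] at h
  exact h.2 ⟨h.1, v, hv, hf⟩

/-- If the edges of `G` are those of a triangle `abc`, one further edge at each of `a`, `b`, `c`,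
and one more edge `xy`, then the coline graph of `G` is not Hamiltonian: each of the three triangle
edges has at most two neighbours there, and `xy` is one of them. -/
lemma coline_not_isHamiltonian_of_edgeSet_eq {V : Type*} [DecidableEq V] {G : SimpleGraph V}
    [Fintype G.edgeSet] {a b c a' b' c' x y : V} (hab : a ≠ b) (hac : a ≠ c) (hbc : b ≠ c)
    (hE : G.edgeSet = {s(a, b), s(a, c), s(b, c), s(a, a'), s(b, b'), s(c, c'), s(x, y)}) :
    ¬ (coline G).IsHamiltonian := by
  refine not_isHamiltonian_of_three_neighborSet_subset
    (x := ⟨s(a, b), by simp [hE]⟩) (y := ⟨s(a, c), by simp [hE]⟩) (z := ⟨s(b, c), by simp [hE]⟩)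
    (u := ⟨s(c, c'), by simp [hE]⟩) (v := ⟨s(b, b'), by simp [hE]⟩) (w := ⟨s(a, a'), by simp [hE]⟩)
    (g := ⟨s(x, y), by simp [hE]⟩)
    (by simp [hbc, hac]) (by simp [hab, hac]) (by simp [hab, hbc.symm]) ?_ ?_ ?_
  all_goals
    rintro ⟨f, hf⟩ h
    have h₁ := not_mem_of_coline_adj h (Sym2.mem_mk_left _ _)
    have h₂ := not_mem_of_coline_adj h (Sym2.mem_mk_right _ _)
    rw [hE] at hf
    rcases hf with rfl | rfl | rfl | rfl | rfl | rfl | rfl <;> simp at h₁ h₂ ⊢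

/-- None of the coline graphs of `H1`, `H2`, `H3` is Hamiltonian. -/
theorem coline_H123_not_hamiltonian :
    ¬ (coline H1).IsHamiltonian ∧ ¬ (coline H2).IsHamiltonian ∧
      ¬ (coline H3).IsHamiltonian := by
  refine ⟨?_, ?_, ?_⟩
  · refine coline_not_isHamiltonian_of_edgeSet_eq (a := 0) (b := 1) (c := 2) (a' := 3) (b' := 4)
      (c' := 5) (x := 3) (y := 4) (by decide) (by decide) (by decide) (Set.ext fun e => ?_)
    simp only [H1, edgeSet_fromEdgeSet]
    revert e
    decide
  · refine coline_not_isHamiltonian_of_edgeSet_eq (a := 0) (b := 1) (c := 2) (a' := 3) (b' := 4)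
      (c' := 5) (x := 3) (y := 6) (by decide) (by decide) (by decide) (Set.ext fun e => ?_)
    simp only [H2, edgeSet_fromEdgeSet]
    revert e
    decide
  · refine coline_not_isHamiltonian_of_edgeSet_eq (a := 0) (b := 1) (c := 2) (a' := 3) (b' := 4)
      (c' := 5) (x := 6) (y := 7) (by decide) (by decide) (by decide) (Set.ext fun e => ?_)
    simp only [H3, edgeSet_fromEdgeSet]
    revert e
    decide
end

section
/- The coline graphs co(H1), co(H2) and co(H3) are all tough. -/
open SimpleGraph

section Leaders

variable {ι : Type*} [LinearOrder ι] (A : ι → ι → Prop) [DecidableRel A]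

/-- The vertices of `T` reached from `i` by a path in `T` with at most `n` steps. -/
def ballIn (T : Finset ι) : ℕ → ι → Finset ι
  | 0, i => {i}
  | n + 1, i => T.filter fun j => ∃ k ∈ ballIn T n i, k = j ∨ A k j

/-- The vertices of `T` that are not within distance `n` in `T` of any smaller vertex of `T`. -/
def leaders (T : Finset ι) (n : ℕ) : Finset ι :=
  T.filter fun r => ∀ i ∈ T, i < r → r ∉ ballIn A T n i

variable {A}

lemma leaders_subset (T : Finset ι) (n : ℕ) : leaders A T n ⊆ T :=
  Finset.filter_subset _ _

lemma reachable_of_mem_ballIn {W : Type*} {L : SimpleGraph W} {f : ι → W}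
    (hA : ∀ i j, A i j → L.Adj (f i) (f j)) {S : Set W} {T : Finset ι}
    (hT : ∀ i, i ∈ T ↔ f i ∈ Sᶜ) {n : ℕ} {i j : ι} (hi : i ∈ T) (hj : j ∈ T)
    (h : j ∈ ballIn A T n i) :
    (L.induce Sᶜ).Reachable ⟨f i, (hT i).1 hi⟩ ⟨f j, (hT j).1 hj⟩ := by
  induction n generalizing j with
  | zero =>
    obtain rfl : j = i := by simpa [ballIn] using h
    exact .refl _
  | succ n ih =>
    obtain ⟨-, k, hk, hkj⟩ := Finset.mem_filter.1 h
    have hkT : k ∈ T := by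
      cases n with
      | zero =>
        obtain rfl : k = i := by simpa [ballIn] using hk
        exact hi
      | succ n => exact (Finset.mem_filter.1 hk).1
    obtain rfl | hkj := hkj
    · exact ih hkT hk
    · exact (ih hkT hk).trans (SimpleGraph.Adj.reachable (hA k j hkj))

lemma exists_leader_reachable [WellFoundedLT ι] {W : Type*}
    {L : SimpleGraph W} {f : ι → W}
    (hA : ∀ i j, A i j → L.Adj (f i) (f j)) {S : Set W} {T : Finset ι}
    (hT : ∀ i, i ∈ T ↔ f i ∈ Sᶜ) (n : ℕ) (j : ι) (hj : j ∈ T) :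
    ∃ r, ∃ hr : r ∈ T, r ∈ leaders A T n ∧
      (L.induce Sᶜ).Reachable ⟨f r, (hT r).1 hr⟩ ⟨f j, (hT j).1 hj⟩ := by
  induction j using WellFoundedLT.induction with
  | ind j ih =>
    by_cases h : j ∈ leaders A T n
    · exact ⟨j, hj, h, .refl _⟩
    · simp only [leaders, Finset.mem_filter, hj, true_and, not_forall, not_not] at h
      obtain ⟨i, hi, hij, hji⟩ := h
      obtain ⟨r, hr, hrl, hri⟩ := ih i hij hi
      exact ⟨r, hr, hrl, hri.trans (reachable_of_mem_ballIn hA hT hi hj hji)⟩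

lemma isTough_of_card_leaders_le [Fintype ι] {W : Type*}
    {L : SimpleGraph W} {f : ι → W} (hf : f.Bijective)
    (hA : ∀ i j, A i j → L.Adj (f i) (f j)) (n : ℕ)
    (h : ∀ T : Finset ι, (leaders A T n).card ≤ max 1 Tᶜ.card) : IsTough L := by
  classical
  intro S hS
  let T : Finset ι := Finset.univ.filter fun i => f i ∈ Sᶜ
  have hT : ∀ i, i ∈ T ↔ f i ∈ Sᶜ := by simp [T]
  let c : leaders A T n → (L.induce Sᶜ).ConnectedComponent := fun r =>
    (L.induce Sᶜ).connectedComponentMk ⟨f r, (hT r).1 (leaders_subset T n r.2)⟩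
  have hc : c.Surjective := by
    refine SimpleGraph.ConnectedComponent.ind ?_
    rintro ⟨v, hv⟩
    obtain ⟨j, rfl⟩ := hf.2 v
    obtain ⟨r, hr, hrl, hrj⟩ := exists_leader_reachable hA hT n j ((hT j).2 hv)
    exact ⟨⟨r, hrl⟩, SimpleGraph.ConnectedComponent.sound hrj⟩
  have hcard : Nat.card (L.induce Sᶜ).ConnectedComponent ≤ max 1 Tᶜ.card :=
    (Nat.card_le_card_of_surjective c hc).trans ((Nat.card_eq_finsetCard _).trans_le (h T))
  have hTS : Tᶜ.card = Nat.card S := by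
    rw [← Nat.card_preimage_of_injective hf.1 fun x _ => hf.2 x, ← Nat.card_eq_finsetCard]
    exact Nat.card_congr (.subtypeEquivRight fun i => by simp [T])
  rw [hTS] at hcard
  obtain hS₀ | hS₀ := (Nat.card S).eq_zero_or_pos
  · by_cases hne : Nonempty (Sᶜ : Set W)
    · refine absurd ⟨fun u v => ?_⟩ hS
      have := Finite.of_surjective c hc
      have := Finite.card_le_one_iff_subsingleton.1 (hS₀ ▸ hcard)
      exact SimpleGraph.ConnectedComponent.exact (Subsingleton.elim _ _)
    · have : IsEmpty (L.induce Sᶜ).ConnectedComponent :=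
        ⟨SimpleGraph.ConnectedComponent.ind fun v => hne ⟨v⟩⟩
      simp
  · rwa [max_eq_right hS₀] at hcard

end Leaders

/-- The coline graph of a graph whose edges are listed without repetition by `p` is tough if
the graph of disjointness between the listed pairs passes the test on leaders. -/
lemma isTough_coline_of_card_leaders_le {V ι : Type*} [DecidableEq V] [LinearOrder ι]
    [Fintype ι] {G : SimpleGraph V} (p : ι → V × V)
    (hG : Set.range (fun i => s((p i).1, (p i).2)) = G.edgeSet)
    (hp : Function.Injective fun i => s((p i).1, (p i).2)) (n : ℕ)
    (h : ∀ T : Finset ι, (leaders (fun i j => (p i).1 ≠ (p j).1 ∧ (p i).1 ≠ (p j).2 ∧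
      (p i).2 ≠ (p j).1 ∧ (p i).2 ≠ (p j).2) T n).card ≤ max 1 Tᶜ.card) :
    IsTough (coline G) := by
  refine isTough_of_card_leaders_le (W := G.edgeSet)
    (f := fun i => ⟨s((p i).1, (p i).2), hG ▸ Set.mem_range_self i⟩) ⟨?_, ?_⟩ ?_ n h
  · exact fun i j hij => hp (Subtype.ext_iff.1 hij)
  · rintro ⟨e, he⟩
    obtain ⟨i, rfl⟩ := hG.symm ▸ he
    exact ⟨i, rfl⟩
  · rintro i j ⟨h₁, h₂, h₃, h₄⟩
    rw [coline, SimpleGraph.compl_adj, SimpleGraph.lineGraph_adj_iff_exists]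
    refine ⟨fun hij => ?_, ?_⟩
    · have := Subtype.ext_iff.1 hij
      simp at this
      grind [Prod.swap]
    · rintro ⟨-, x, hx, hy⟩
      simp at hx hy
      grind

/-- The coline graphs of `H1`, `H2` and `H3` are all tough. -/
theorem coline_H123_tough :
    IsTough (coline H1) ∧ IsTough (coline H2) ∧ IsTough (coline H3) := by
  refine ⟨isTough_coline_of_card_leaders_le
      ![(0, 1), (0, 2), (1, 2), (0, 3), (1, 4), (2, 5), (3, 4)] ?_ (by decide) 3 (by decide +kernel),
    isTough_coline_of_card_leaders_le
      ![(0, 1), (0, 2), (1, 2), (0, 3), (1, 4), (2, 5), (3, 6)] ?_ (by decide) 3 (by decide +kernel),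
    isTough_coline_of_card_leaders_le
      ![(0, 1), (0, 2), (1, 2), (0, 3), (1, 4), (2, 5), (6, 7)] ?_ (by decide) 3 (by decide +kernel)⟩
  all_goals
    ext e
    simp only [H1, H2, H3, Set.mem_range, Fin.exists_fin_succ, SimpleGraph.edgeSet_fromEdgeSet]
    simp [eq_comm (b := e)]
    rintro (rfl | rfl | rfl | rfl | rfl | rfl | rfl) <;> decide
end

section
/- Let G be a finite simple graph with m edges and maximum degree Δ ≥ 2. If m < 2Δ, then the coline graph co(G) is not tough. -/
open SimpleGraph

/-- The edges of `G` at a common vertex are pairwise nonadjacent in the coline graph. -/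
theorem coline_induce_incidence_eq_bot {V : Type*} (G : SimpleGraph V) (v : V) :
    (coline G).induce {e : G.edgeSet | v ∈ (e : Sym2 V)} = ⊥ := by
  ext a b
  simp only [comap_adj, Function.Embedding.subtype_apply, bot_adj, iff_false, coline,
    compl_adj, lineGraph_adj_iff_exists]
  exact fun h => h.2 ⟨h.1, v, a.2, b.2⟩

/-- In a tough finite graph, a set of at least two pairwise nonadjacent vertices is no larger
than its complement. -/
theorem IsTough.ncard_le_ncard_compl {W : Type*} {L : SimpleGraph W} (hL : IsTough L)
    {I : Set W} (hI : L.induce I = ⊥) (h2 : 2 ≤ I.ncard) : I.ncard ≤ Iᶜ.ncard := by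
  obtain ⟨a, b, ha, hb, hab⟩ := (Set.one_lt_ncard_iff (Set.finite_of_ncard_pos (by omega))).1 h2
  have h := hL Iᶜ
  rw [compl_compl, hI] at h
  have hcard : Nat.card (⊥ : SimpleGraph I).ConnectedComponent = I.ncard := by
    refine (Nat.card_congr (Equiv.ofBijective (connectedComponentMk ⊥) ⟨?_, ?_⟩)).symm
    · intro x y hxy
      exact reachable_bot.1 (ConnectedComponent.exact hxy)
    · exact Quot.mk_surjective
  rw [hcard, Nat.card_coe_set_eq] at h
  refine h fun hc => hab ?_
  exact congrArg Subtype.val (reachable_bot.1 (hc.preconnected ⟨a, ha⟩ ⟨b, hb⟩))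

/-- If `G` has maximum degree `Δ ≥ 2` and fewer than `2Δ` edges, then its coline
graph is not tough. -/
theorem coline_not_tough_of_lt {V : Type*} [Fintype V] [DecidableEq V]
    (G : SimpleGraph V) [DecidableRel G.Adj] (hΔ : 2 ≤ G.maxDegree)
    (hm : G.edgeFinset.card < 2 * G.maxDegree) :
    ¬ IsTough (coline G) := by
  intro hL
  have hV : Nonempty V := by
    by_contra hV
    rw [not_nonempty_iff] at hV
    simp [maxDegree_of_subsingleton] at hΔ
  obtain ⟨v, hv⟩ := G.exists_maximal_degree_vertex
  have hI : {e : G.edgeSet | v ∈ (e : Sym2 V)}.ncard = G.maxDegree := by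
    rw [hv, ← card_incidenceSet_eq_degree, ← Nat.card_eq_fintype_card, Nat.card_coe_set_eq,
      ← Set.ncard_image_of_injective _ Subtype.val_injective]
    congr 1
    ext e
    simp [incidenceSet, and_comm]
  have h := hL.ncard_le_ncard_compl (coline_induce_incidence_eq_bot G v) (by rwa [hI])
  have hsum := Set.ncard_add_ncard_compl {e : G.edgeSet | v ∈ (e : Sym2 V)}
  rw [Nat.card_eq_fintype_card, ← edgeFinset_card] at hsum
  omega
end

section
/- Let G be a finite simple graph with m edges and maximum degree Δ ≥ 2. If m = 2Δ and G has two adjacent vertices each of degree Δ, then the coline graph co(G) is not tough. -/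
open SimpleGraph

/-- The edges missing both endpoints of an edge `uv` number `m - (deg u + deg v - 1)`. -/
theorem card_edges_avoiding_add {V : Type*} [Fintype V] [DecidableEq V]
    (G : SimpleGraph V) [DecidableRel G.Adj] {u v : V} (h : G.Adj u v) :
    (G.edgeFinset.filter fun e => u ∉ e ∧ v ∉ e).card + (G.degree u + G.degree v) =
      G.edgeFinset.card + 1 := by
  have hinter : G.incidenceFinset u ∩ G.incidenceFinset v = {s(u, v)} := by
    ext e
    simp only [Finset.mem_inter, mem_incidenceFinset, Finset.mem_singleton, incidenceSet,
      Set.mem_sep_iff]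
    constructor
    · rintro ⟨⟨_, hu⟩, _, hv⟩
      exact (Sym2.mem_and_mem_iff h.ne).1 ⟨hu, hv⟩
    · rintro rfl
      simp [h]
  have hunion := Finset.card_union_add_card_inter (G.incidenceFinset u) (G.incidenceFinset v)
  rw [hinter, Finset.card_singleton, card_incidenceFinset_eq_degree,
    card_incidenceFinset_eq_degree] at hunion
  have hsplit := Finset.card_filter_add_card_filter_not (s := G.edgeFinset)
    (fun e => u ∉ e ∧ v ∉ e)
  have hcompl : (G.edgeFinset.filter fun e => ¬ (u ∉ e ∧ v ∉ e)) =
      G.incidenceFinset u ∪ G.incidenceFinset v := by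
    ext e
    simp only [Finset.mem_filter, Finset.mem_union, mem_incidenceFinset, mem_edgeFinset,
      incidenceSet, Set.mem_sep_iff]
    tauto
  rw [hcompl] at hsplit
  omega

/-- In the coline graph, an edge of `G` is not adjacent to any edge sharing an endpoint with it. -/
theorem not_coline_adj_of_mem {V : Type*} {G : SimpleGraph V} {e f : G.edgeSet} {x : V}
    (he : x ∈ (e : Sym2 V)) (hf : x ∈ (f : Sym2 V)) : ¬ (coline G).Adj e f := by
  rw [coline, compl_adj, lineGraph_adj_iff_exists]
  exact fun ⟨hne, h⟩ => h ⟨hne, x, he, hf⟩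

theorem IsTough.connected_induce_compl {W : Type*} [Finite W] {L : SimpleGraph W}
    (hL : IsTough L) {S : Set W} (hS : Nat.card S ≤ 1) (hne : Sᶜ.Nonempty) :
    (L.induce Sᶜ).Connected := by
  by_contra hcon
  have hsub : Subsingleton (L.induce Sᶜ).ConnectedComponent :=
    Finite.card_le_one_iff_subsingleton.1 ((hL S hcon).trans hS)
  have := hne.to_subtype
  exact hcon ⟨fun a b => ConnectedComponent.exact (Subsingleton.elim _ _)⟩

/-- If `G` has maximum degree `Δ ≥ 2`, exactly `2Δ` edges and two adjacent vertices
of degree `Δ`, then its coline graph is not tough. -/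
theorem coline_not_tough_of_eq {V : Type*} [Fintype V] [DecidableEq V]
    (G : SimpleGraph V) [DecidableRel G.Adj] (hΔ : 2 ≤ G.maxDegree)
    (hm : G.edgeFinset.card = 2 * G.maxDegree)
    (hadj : ∃ u v : V, G.Adj u v ∧ G.degree u = G.maxDegree ∧ G.degree v = G.maxDegree) :
    ¬ IsTough (coline G) := by
  intro htough
  obtain ⟨u, v, h, hu, hv⟩ := hadj
  have hcount := card_edges_avoiding_add G h
  set S : Set G.edgeSet := {e | u ∉ (e : Sym2 V) ∧ v ∉ (e : Sym2 V)} with hSdef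
  have hS : Nat.card S ≤ 1 := by
    have hle : Nat.card S ≤ Nat.card (G.edgeFinset.filter fun e => u ∉ e ∧ v ∉ e) :=
      Nat.card_le_card_of_injective
        (fun e => ⟨e.1.1, Finset.mem_filter.2 ⟨mem_edgeFinset.2 e.1.2, e.2⟩⟩)
        fun a b hab => Subtype.ext (Subtype.ext (by simpa using hab))
    rw [Nat.card_eq_fintype_card (α := Finset.filter _ _), Fintype.card_coe] at hle
    omega
  obtain ⟨w, hw, hwv⟩ : ∃ w ∈ G.neighborFinset u, w ≠ v :=
    Finset.exists_mem_ne (by rw [card_neighborFinset_eq_degree]; omega) v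
  rw [mem_neighborFinset] at hw
  have he : (⟨s(u, v), h⟩ : G.edgeSet) ∈ Sᶜ := by simp [hSdef]
  have hf : (⟨s(u, w), hw⟩ : G.edgeSet) ∈ Sᶜ := by simp [hSdef]
  have hcon := htough.connected_induce_compl hS ⟨_, he⟩
  have hne : (⟨_, he⟩ : (Sᶜ : Set G.edgeSet)) ≠ ⟨_, hf⟩ := fun heq =>
    hwv (Sym2.congr_right.1 (congrArg (fun x => x.1.1) heq)).symm
  have : Nontrivial (Sᶜ : Set G.edgeSet) := ⟨_, _, hne⟩
  obtain ⟨g, hg⟩ := hcon.preconnected.exists_adj_of_nontrivial ⟨_, he⟩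
  rw [comap_adj] at hg
  have hgS : u ∈ (g.1 : Sym2 V) ∨ v ∈ (g.1 : Sym2 V) := by
    have := g.2
    simp only [hSdef, Set.mem_compl_iff, Set.mem_ofPred_eq] at this
    tauto
  rcases hgS with hg' | hg'
  · exact not_coline_adj_of_mem (by simp) hg' hg
  · exact not_coline_adj_of_mem (by simp) hg' hg
end

section
/- Let G be a finite simple graph with m edges and maximum degree Δ ≥ 2. If m = 2Δ − 1 and G has two adjacent vertices each of degree Δ, then the coline graph co(G) is not traceable. -/
open SimpleGraph

/-- A graph is traceable if it has a Hamiltonian path. -/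
def Traceable {W : Type*} [DecidableEq W] (L : SimpleGraph W) : Prop :=
  ∃ (u w : W) (p : L.Walk u w), p.IsHamiltonian

/-- If a graph has fewer edges than the sum of the degrees of two distinct vertices, then
every edge contains one of these vertices. -/
theorem SimpleGraph.mem_or_mem_of_card_edgeFinset_lt {V : Type*} [Fintype V] [DecidableEq V]
    (G : SimpleGraph V) [DecidableRel G.Adj] {u v : V} (huv : u ≠ v)
    (hm : G.edgeFinset.card < G.degree u + G.degree v) {e : Sym2 V} (he : e ∈ G.edgeSet) :
    u ∈ e ∨ v ∈ e := by
  have hinter : (G.incidenceFinset u ∩ G.incidenceFinset v).card ≤ 1 := by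
    rw [← Finset.card_singleton s(u, v)]
    refine Finset.card_le_card fun x hx => ?_
    rw [Finset.mem_inter, mem_incidenceFinset, mem_incidenceFinset] at hx
    exact Finset.mem_singleton.2 ((Sym2.mem_and_mem_iff huv).1 ⟨hx.1.2, hx.2.2⟩)
  have hcard := Finset.card_union_add_card_inter (G.incidenceFinset u) (G.incidenceFinset v)
  rw [card_incidenceFinset_eq_degree, card_incidenceFinset_eq_degree] at hcard
  have hsub : G.incidenceFinset u ∪ G.incidenceFinset v ⊆ G.edgeFinset :=
    Finset.union_subset (G.incidenceFinset_subset u) (G.incidenceFinset_subset v)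
  have hmem : e ∈ G.incidenceFinset u ∪ G.incidenceFinset v := by
    rw [Finset.eq_of_subset_of_card_le hsub (by omega)]
    exact mem_edgeFinset.2 he
  rw [Finset.mem_union, mem_incidenceFinset, mem_incidenceFinset] at hmem
  exact hmem.imp And.right And.right

/-- Every vertex of a nontrivial traceable graph has a neighbor. -/
theorem Traceable.exists_adj {W : Type*} [DecidableEq W] [Nontrivial W] {L : SimpleGraph W}
    (h : Traceable L) (x : W) : ∃ y, L.Adj x y := by
  obtain ⟨a, b, p, hp⟩ := h
  obtain ⟨y, hy⟩ := exists_ne x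
  have hr : L.Reachable x y :=
    (p.takeUntil x (hp.mem_support x)).reachable.symm.trans
      (p.takeUntil y (hp.mem_support y)).reachable
  obtain ⟨q⟩ := hr
  cases q with
  | nil => exact absurd rfl hy
  | cons hadj _ => exact ⟨_, hadj⟩

/-- If `G` has maximum degree `Δ ≥ 2`, exactly `2Δ - 1` edges and two adjacent
vertices of degree `Δ`, then its coline graph is not traceable. -/
theorem coline_not_traceable_of_eq {V : Type*} [Fintype V] [DecidableEq V]
    (G : SimpleGraph V) [DecidableRel G.Adj] (hΔ : 2 ≤ G.maxDegree)
    (hm : G.edgeFinset.card = 2 * G.maxDegree - 1)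
    (hadj : ∃ u v : V, G.Adj u v ∧ G.degree u = G.maxDegree ∧ G.degree v = G.maxDegree) :
    ¬ Traceable (coline G) := by
  obtain ⟨u, v, huv, hu, hv⟩ := hadj
  intro hT
  have : Nontrivial G.edgeSet := by
    rw [← Fintype.one_lt_card_iff_nontrivial, ← edgeFinset_card]
    omega
  obtain ⟨e, he⟩ := hT.exists_adj ⟨s(u, v), huv⟩
  rw [coline, compl_adj, lineGraph_adj_iff_exists] at he
  refine he.2 ⟨he.1, ?_⟩
  rcases G.mem_or_mem_of_card_edgeFinset_lt huv.ne (by omega) e.2 with h | h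
  · exact ⟨u, Sym2.mem_mk_left u v, h⟩
  · exact ⟨v, Sym2.mem_mk_right u v, h⟩
end
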